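/- Let X be a partial EFX allocation for agents with non-degenerate cancelable valuations, let g be an unallocated item, and let C be a good g-cycle with induced decompositions X_j = T_j ∪ B_j for agents j on C. Then for every agent i on C there exists an agent a (not necessarily on C) such that a ▷_{B_i | B_{succ(i)}} succ(i); in particular, the set T_{succ(i)} ∪ B_i has a most envious agent. -/

import Mathlib

namespace FairDivision

open Finset

/-- A valuation: nonnegative, zero on the empty set, monotone. -/
def IsValuation {ι : Type*} (v : Finset ι → ℝ) : Prop :=
  v ∅ = 0 ∧ (∀ S : Finset ι, 0 ≤ v S) ∧ ∀ ⦃S T : Finset ι⦄, S ⊆ T → v S ≤ v T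

/-- `v` is cancelable: `v (S ∪ {g}) > v (T ∪ {g})` implies `v S > v T`. -/
def Cancelable {ι : Type*} [DecidableEq ι] (v : Finset ι → ℝ) : Prop :=
  ∀ S T : Finset ι, ∀ g : ι, g ∉ S → g ∉ T →
    v (insert g S) > v (insert g T) → v S > v T

/-- `v` is non-degenerate: distinct bundles have distinct values. -/
def NonDegenerate {ι : Type*} (v : Finset ι → ℝ) : Prop :=
  ∀ S T : Finset ι, S ≠ T → v S ≠ v T

/-- `v'` respects `v`: every strict inequality of `v` is a strict inequality of `v'`. -/
def Respects {ι : Type*} (v' v : Finset ι → ℝ) : Prop :=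
  ∀ S T : Finset ι, v S > v T → v' S > v' T

/-- `v` is a nice cancelable valuation: cancelable, and some non-degenerate
cancelable valuation respects it. -/
def NiceCancelable {ι : Type*} [DecidableEq ι] (v : Finset ι → ℝ) : Prop :=
  Cancelable v ∧ ∃ v' : Finset ι → ℝ,
    IsValuation v' ∧ NonDegenerate v' ∧ Cancelable v' ∧ Respects v' v

/-- A partial allocation: the bundles are pairwise disjoint. -/
def IsPartialAlloc {ι : Type*} {n : ℕ} (X : Fin n → Finset ι) : Prop :=
  ∀ i j : Fin n, i ≠ j → Disjoint (X i) (X j)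

/-- The set of unallocated items. -/
def unalloc {ι : Type*} [DecidableEq ι] [Fintype ι] {n : ℕ}
    (X : Fin n → Finset ι) : Finset ι :=
  Finset.univ \ Finset.univ.biUnion X

/-- Agent `i` envies the set `S`. -/
def EnviesSet {ι : Type*} {n : ℕ} (v : Fin n → Finset ι → ℝ) (X : Fin n → Finset ι)
    (i : Fin n) (S : Finset ι) : Prop :=
  v i (X i) < v i S

/-- Agent `i` strongly envies the set `S`. -/
def StrongEnviesSet {ι : Type*} [DecidableEq ι] {n : ℕ} (v : Fin n → Finset ι → ℝ)
    (X : Fin n → Finset ι) (i : Fin n) (S : Finset ι) : Prop :=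
  ∃ h ∈ S, v i (X i) < v i (S.erase h)

/-- The allocation is EFX: no agent strongly envies another agent's bundle. -/
def IsEFX {ι : Type*} [DecidableEq ι] {n : ℕ} (v : Fin n → Finset ι → ℝ)
    (X : Fin n → Finset ι) : Prop :=
  ∀ i j : Fin n, i ≠ j → ¬ StrongEnviesSet v X i (X j)

/-- `Y` Pareto dominates `X`. -/
def ParetoDominates {ι : Type*} {n : ℕ} (v : Fin n → Finset ι → ℝ)
    (Y X : Fin n → Finset ι) : Prop :=
  (∀ i, v i (X i) ≤ v i (Y i)) ∧ ∃ i, v i (X i) < v i (Y i)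

/-- `Y` dominates `X` lexicographically with respect to the ordering `a` of the agents. -/
def Dominates {ι : Type*} {n : ℕ} (v : Fin n → Finset ι → ℝ) (a : Fin n → Fin n)
    (Y X : Fin n → Finset ι) : Prop :=
  ∃ k : Fin n, (∀ j : Fin n, j < k → v (a j) (Y (a j)) = v (a j) (X (a j))) ∧
    v (a k) (X (a k)) < v (a k) (Y (a k))

/-- Agent `i` is a most envious agent of the set `S`: there is `T ⊆ S` that `i`
envies and that no agent strongly envies.  (`S \ T` is a corresponding discard set.) -/
def MostEnvious {ι : Type*} [DecidableEq ι] {n : ℕ} (v : Fin n → Finset ι → ℝ)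
    (X : Fin n → Finset ι) (i : Fin n) (S : Finset ι) : Prop :=
  ∃ T ⊆ S, EnviesSet v X i T ∧ ∀ j : Fin n, ¬ StrongEnviesSet v X j T

/-- `i` champions `j` with respect to the item `g`:  `i` is a most envious agent
of `X j ∪ {g}`. -/
def ChampG {ι : Type*} [DecidableEq ι] {n : ℕ} (v : Fin n → Finset ι → ℝ)
    (X : Fin n → Finset ι) (g : ι) (i j : Fin n) : Prop :=
  MostEnvious v X i (insert g (X j))

/-- `i` champions `j` with respect to `(H | S)`:  `H ⊆ M \ X j`, `S ⊆ X j`, and `i`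
is a most envious agent of `(X j \ S) ∪ H`. -/
def GenChamp {ι : Type*} [DecidableEq ι] {n : ℕ} (v : Fin n → Finset ι → ℝ)
    (X : Fin n → Finset ι) (i j : Fin n) (H S : Finset ι) : Prop :=
  Disjoint H (X j) ∧ S ⊆ X j ∧ MostEnvious v X i ((X j \ S) ∪ H)

/-- A good `g`-cycle for the partial EFX allocation `X`: a cycle of `k ≥ 2`
distinct agents all of whose edges are `g`-champion edges, with no parallel envy
edges and no internal `g`-champion edges, together with the induced
`g`-decompositions `X (a t) = T t ∪ B t`: `B t` is the (bottom half-bundle)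
discard set of the edge from the predecessor of `a t` into `a t`, so `a t`
envies `(X (a (t+1)) \ B (t+1)) ∪ {g}` and no agent strongly envies it. -/
structure GoodCycle {ι : Type*} [DecidableEq ι] [Fintype ι] {n : ℕ}
    (v : Fin n → Finset ι → ℝ) (X : Fin n → Finset ι) (g : ι) where
  k : ℕ
  two_le : 2 ≤ k
  a : ZMod k → Fin n
  inj : Function.Injective a
  champ : ∀ t : ZMod k, ChampG v X g (a t) (a (t + 1))
  no_envy : ∀ t : ZMod k, ¬ EnviesSet v X (a t) (X (a (t + 1)))
  no_internal : ∀ t s : ZMod k, ChampG v X g (a t) (a s) → s = t + 1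
  B : ZMod k → Finset ι
  B_sub : ∀ t : ZMod k, B t ⊆ X (a t)
  g_notin_B : ∀ t : ZMod k, g ∉ B t
  B_envy : ∀ t : ZMod k, EnviesSet v X (a t) (insert g (X (a (t + 1)) \ B (t + 1)))
  B_no_strong : ∀ (t : ZMod k) (j : Fin n),
    ¬ StrongEnviesSet v X j (insert g (X (a (t + 1)) \ B (t + 1)))

/-- Adding items outside both bundles preserves weak preferences of a cancelable valuation. -/
theorem Cancelable.union_le_union {ι : Type*} [DecidableEq ι] {v : Finset ι → ℝ}
    (hv : Cancelable v) {S T : Finset ι} (h : v S ≤ v T) (R : Finset ι)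
    (hS : Disjoint S R) (hT : Disjoint T R) : v (S ∪ R) ≤ v (T ∪ R) := by
  induction R using Finset.induction_on with
  | empty => simpa using h
  | insert x R hx ih =>
    rw [Finset.disjoint_insert_right] at hS hT
    rw [Finset.union_insert, Finset.union_insert]
    by_contra! hlt
    exact absurd (hv (S ∪ R) (T ∪ R) x (by simp [hS.1, hx]) (by simp [hT.1, hx]) hlt)
      (not_lt.mpr (ih hS.2 hT.2))

/-- Adding items outside both bundles preserves strict preferences of a non-degenerate
cancelable valuation. -/
theorem Cancelable.union_lt_union {ι : Type*} [DecidableEq ι] {v : Finset ι → ℝ}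
    (hv : Cancelable v) (hnd : NonDegenerate v) {S T : Finset ι} (h : v S < v T) (R : Finset ι)
    (hS : Disjoint S R) (hT : Disjoint T R) : v (S ∪ R) < v (T ∪ R) := by
  refine lt_of_le_of_ne (hv.union_le_union h.le R hS hT) (hnd _ _ fun heq => ?_)
  have hST : S = T := by
    rw [← Finset.union_sdiff_cancel_right hS, heq, Finset.union_sdiff_cancel_right hT]
  exact h.ne (congrArg v hST)

/-- A set that some agent envies has a most envious agent. -/
theorem EnviesSet.exists_mostEnvious {ι : Type*} [DecidableEq ι] {n : ℕ}
    {v : Fin n → Finset ι → ℝ} {X : Fin n → Finset ι} {i : Fin n} {S : Finset ι}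
    (h : EnviesSet v X i S) : ∃ b, MostEnvious v X b S := by
  induction S using Finset.strongInduction generalizing i with
  | H S ih =>
    by_cases hs : ∃ j, StrongEnviesSet v X j S
    · obtain ⟨j, x, hx, hj⟩ := hs
      obtain ⟨b, T, hT, hb⟩ := ih _ (Finset.erase_ssubset hx) (i := j) hj
      exact ⟨b, T, hT.trans (Finset.erase_subset x S), hb⟩
    · exact ⟨i, S, Finset.Subset.refl S, h, not_exists.mp hs⟩

theorem notMem_of_mem_unalloc {ι : Type*} [DecidableEq ι] [Fintype ι] {n : ℕ}
    {X : Fin n → Finset ι} {g : ι} (hg : g ∈ unalloc X) (i : Fin n) : g ∉ X i := fun h =>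
  (Finset.mem_sdiff.mp hg).2 (Finset.mem_biUnion.mpr ⟨i, Finset.mem_univ i, h⟩)

namespace GoodCycle

variable {ι : Type*} [DecidableEq ι] [Fintype ι] {n : ℕ} {v : Fin n → Finset ι → ℝ}
  {X : Fin n → Finset ι} {g : ι}

theorem ne_add_one (C : GoodCycle v X g) (t : ZMod C.k) : t ≠ t + 1 := by
  have : Fact (1 < C.k) := ⟨C.two_le⟩
  simp

/-- An agent on a good cycle does not envy its own top half-bundle together with `g`. -/
theorem not_enviesSet_top (C : GoodCycle v X g) (t : ZMod C.k) :
    ¬ EnviesSet v X (C.a t) (insert g (X (C.a t) \ C.B t)) := fun h => by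
  have hs := C.B_no_strong (t - 1)
  rw [sub_add_cancel] at hs
  exact C.ne_add_one t (C.no_internal t t
    ⟨_, Finset.insert_subset_insert g Finset.sdiff_subset, h, hs⟩)

/-- An agent on a good cycle strictly prefers the top half-bundle of its successor to its own. -/
theorem top_lt_top_succ (C : GoodCycle v X g) (hc : ∀ i, Cancelable (v i))
    (hg : g ∈ unalloc X) (t : ZMod C.k) :
    v (C.a t) (X (C.a t) \ C.B t) < v (C.a t) (X (C.a (t + 1)) \ C.B (t + 1)) :=
  hc _ _ _ g (fun h => notMem_of_mem_unalloc hg _ (Finset.sdiff_subset h))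
    (fun h => notMem_of_mem_unalloc hg _ (Finset.sdiff_subset h))
    ((not_lt.mp (C.not_enviesSet_top t)).trans_lt (C.B_envy t))

end GoodCycle

/-- Let `C` be a good `g`-cycle for a partial EFX allocation `X`
(agents with non-degenerate cancelable valuations, `g` unallocated).  Then for
every agent `a t` on the cycle there exists an agent `b` such that
`b ▷_{B t | B (t+1)} a (t+1)`; in particular `T (t+1) ∪ B t` has a most envious
agent. -/
theorem good_cycle_edge_discovery_start
    {ι : Type*} [DecidableEq ι] [Fintype ι] {n : ℕ}
    (v : Fin n → Finset ι → ℝ) (hval : ∀ i, IsValuation (v i))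
    (hnd : ∀ i, NonDegenerate (v i)) (hc : ∀ i, Cancelable (v i))
    (X : Fin n → Finset ι) (hX : IsPartialAlloc X) (hEFX : IsEFX v X)
    (g : ι) (hg : g ∈ unalloc X) (C : GoodCycle v X g) :
    ∀ t : ZMod C.k, ∃ b : Fin n,
      GenChamp v X b (C.a (t + 1)) (C.B t) (C.B (t + 1)) := by
  intro t
  have hdisj : Disjoint (C.B t) (X (C.a (t + 1))) :=
    (hX _ _ (C.inj.ne (C.ne_add_one t))).mono_left (C.B_sub t)
  have henvy : EnviesSet v X (C.a t) ((X (C.a (t + 1)) \ C.B (t + 1)) ∪ C.B t) := by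
    have h := (hc (C.a t)).union_lt_union (hnd _) (C.top_lt_top_succ hc hg t) (C.B t)
      Finset.sdiff_disjoint (hdisj.symm.mono_left Finset.sdiff_subset)
    rwa [Finset.sdiff_union_of_subset (C.B_sub t)] at h
  obtain ⟨b, hb⟩ := henvy.exists_mostEnvious
  exact ⟨b, hdisj, C.B_sub _, hb⟩

end FairDivision
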